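/- Let m ≥ 2 be an integer, let A_m be the dihedral Artin group on generators s, t with exponent m, let Δ be the image of prod(s,t;m), and let z be the central element (z = Δ for m even, z = Δ² for m odd). For h ∈ A_m: if ⟨s⟩ ∩ h⟨t⟩h⁻¹ ≠ {1}, then m is odd and there exists w ∈ ⟨z⟩ such that the cosets h⟨t⟩ and Δw⟨t⟩ coincide; in particular h⟨t⟩h⁻¹ = ⟨s⟩. -/

import Mathlib

/-- The alternating product `a b a b ⋯` with `k` letters, starting with `a`. -/
def altProd {G : Type*} [Monoid G] (a b : G) : ℕ → G
  | 0 => 1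
  | n + 1 => a * altProd b a n

/-- The braid relation `prod(s,t;m) = prod(t,s;m)` for the dihedral Artin group,
as a single relator in the free group on two generators. -/
def braidRels (m : ℕ) : Set (FreeGroup (Fin 2)) :=
  {altProd (FreeGroup.of 0) (FreeGroup.of 1) m * (altProd (FreeGroup.of 1) (FreeGroup.of 0) m)⁻¹}

/-- The dihedral Artin group `⟨s, t | prod(s,t;m) = prod(t,s;m)⟩`. -/
abbrev DihedralArtin (m : ℕ) : Type := PresentedGroup (braidRels m)

/-- The generators of the dihedral Artin group: `s = Dgen m 0` and `t = Dgen m 1`. -/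
def Dgen (m : ℕ) (i : Fin 2) : DihedralArtin m := PresentedGroup.of i

/-- The Garside element `Δ`, the image of `prod(s,t;m)` in the dihedral Artin group. -/
def DDelta (m : ℕ) : DihedralArtin m := altProd (Dgen m 0) (Dgen m 1) m

/-- The central element `z`: equal to `Δ` for `m` even and to `Δ²` for `m` odd. -/
def Dz (m : ℕ) : DihedralArtin m := if Even m then DDelta m else (DDelta m) ^ 2

/-- The conjugate `g H g⁻¹` of a subgroup. -/
def conjSub {G : Type*} [Group G] (g : G) (H : Subgroup G) : Subgroup G :=
  H.map (MulAut.conj g).toMonoidHom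

theorem map_altProd {G H : Type*} [Monoid G] [Monoid H] (f : G →* H) (a b : G) (n : ℕ) :
    f (altProd a b n) = altProd (f a) (f b) n := by
  induction n generalizing a b with
  | zero => exact map_one f
  | succ n ih => rw [altProd, altProd, map_mul, ih]

theorem altProd_two_mul {G : Type*} [Monoid G] (a b : G) (k : ℕ) :
    altProd a b (2 * k) = (a * b) ^ k := by
  induction k with
  | zero => simp [altProd]
  | succ k ih =>
    rw [show 2 * (k + 1) = 2 * k + 1 + 1 by ring, altProd, altProd, ih, pow_succ', mul_assoc]

theorem altProd_two_mul_add_one {G : Type*} [Monoid G] (a b : G) (k : ℕ) :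
    altProd a b (2 * k + 1) = a * (b * a) ^ k := by
  rw [altProd, altProd_two_mul]

theorem mul_mul_pow_comm {G : Type*} [Monoid G] (a b : G) (k : ℕ) :
    a * (b * a) ^ k = (a * b) ^ k * a :=
  SemiconjBy.eq (SemiconjBy.pow_right (show a * (b * a) = a * b * a from (mul_assoc a b a).symm) k)

namespace DihedralArtin

variable {m : ℕ}

theorem closure_Dgen : Subgroup.closure {Dgen m 0, Dgen m 1} = ⊤ := by
  rw [← PresentedGroup.closure_range_of (braidRels m)]
  congr 1
  ext g
  simp [Dgen, Fin.exists_fin_two, eq_comm]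

theorem braid_relation : altProd (Dgen m 0) (Dgen m 1) m = altProd (Dgen m 1) (Dgen m 0) m := by
  have h := PresentedGroup.one_of_mem (rels := braidRels m) (Set.mem_singleton _)
  rw [map_mul, map_inv, mul_inv_eq_one, map_altProd, map_altProd] at h
  exact h

/-- The homomorphism out of `A_m` given by two elements satisfying the braid relation. -/
def lift {G : Type*} [Group G] (a b : G) (h : altProd a b m = altProd b a m) :
    DihedralArtin m →* G :=
  PresentedGroup.toGroup (f := ![a, b]) (by
    rintro r rfl
    simp [map_altProd, h])

@[simp]
theorem lift_Dgen_zero {G : Type*} [Group G] (a b : G) (h : altProd a b m = altProd b a m) :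
    lift a b h (Dgen m 0) = a :=
  PresentedGroup.toGroup.of _

@[simp]
theorem lift_Dgen_one {G : Type*} [Group G] (a b : G) (h : altProd a b m = altProd b a m) :
    lift a b h (Dgen m 1) = b :=
  PresentedGroup.toGroup.of _

theorem exponents_eq {a b : ℤ} {h : DihedralArtin m}
    (e : Dgen m 0 ^ a = h * Dgen m 1 ^ b * h⁻¹) : a = b := by
  have := congrArg (lift (Multiplicative.ofAdd (1 : ℤ)) (Multiplicative.ofAdd 1) rfl) e
  simpa [mul_comm, ← ofAdd_zsmul] using this

theorem exponent_eq_zero_of_even (hm : Even m) {a b : ℤ} {h : DihedralArtin m}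
    (e : Dgen m 0 ^ a = h * Dgen m 1 ^ b * h⁻¹) : a = 0 := by
  obtain ⟨k, rfl⟩ := hm.two_dvd
  have := congrArg (lift (Multiplicative.ofAdd (1 : ℤ)) 1
    (by rw [altProd_two_mul, altProd_two_mul, mul_comm])) e
  simpa [mul_comm, ← ofAdd_zsmul] using this

section Odd

variable {k : ℕ}

theorem DDelta_eq : DDelta (2 * k + 1) =
    Dgen (2 * k + 1) 1 * (Dgen (2 * k + 1) 0 * Dgen (2 * k + 1) 1) ^ k := by
  rw [DDelta, braid_relation, altProd_two_mul_add_one]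

theorem DDelta_eq' : DDelta (2 * k + 1) =
    (Dgen (2 * k + 1) 0 * Dgen (2 * k + 1) 1) ^ k * Dgen (2 * k + 1) 0 := by
  rw [DDelta, altProd_two_mul_add_one, mul_mul_pow_comm]

theorem Dgen_zero_mul_DDelta :
    Dgen (2 * k + 1) 0 * DDelta (2 * k + 1) = DDelta (2 * k + 1) * Dgen (2 * k + 1) 1 := by
  conv_rhs => rw [DDelta_eq']
  rw [DDelta_eq, ← mul_assoc, mul_assoc (_ ^ k), ← pow_succ, ← pow_succ']

theorem Dgen_one_mul_DDelta :
    Dgen (2 * k + 1) 1 * DDelta (2 * k + 1) = DDelta (2 * k + 1) * Dgen (2 * k + 1) 0 := by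
  conv_rhs => rw [DDelta_eq]
  rw [DDelta_eq', mul_assoc]

theorem Dz_odd : Dz (2 * k + 1) = DDelta (2 * k + 1) * DDelta (2 * k + 1) := by
  rw [Dz, if_neg (by simp), sq]

theorem Dz_commute (g : DihedralArtin (2 * k + 1)) : Commute (Dz (2 * k + 1)) g := by
  have hg : g ∈ Subgroup.closure {Dgen (2 * k + 1) 0, Dgen (2 * k + 1) 1} := by
    rw [closure_Dgen]; trivial
  induction hg using Subgroup.closure_induction with
  | mem x hx =>
    rw [Dz_odd, commute_iff_eq]
    rcases hx with rfl | rfl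
    · rw [mul_assoc, ← Dgen_one_mul_DDelta, ← mul_assoc, ← Dgen_zero_mul_DDelta, mul_assoc]
    · rw [mul_assoc, ← Dgen_zero_mul_DDelta, ← mul_assoc, ← Dgen_one_mul_DDelta, mul_assoc]
  | one => exact Commute.one_right _
  | mul x y _ _ hx hy => exact hx.mul_right hy
  | inv x _ hx => exact hx.inv_right

/-- The element `(st)^k` of `A_{2k+1}`, of finite order modulo `z`. -/
def rot (k : ℕ) : DihedralArtin (2 * k + 1) := (Dgen (2 * k + 1) 0 * Dgen (2 * k + 1) 1) ^ k

theorem rot_eq : rot k = (Dgen (2 * k + 1) 1)⁻¹ * DDelta (2 * k + 1) := by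
  rw [DDelta_eq, inv_mul_cancel_left, rot]

theorem Dgen_one_eq : Dgen (2 * k + 1) 1 = DDelta (2 * k + 1) * (rot k)⁻¹ := by
  rw [rot_eq]; group

theorem rot_pow : rot k ^ (2 * k + 1) = Dz (2 * k + 1) ^ k := by
  have h : (Dgen (2 * k + 1) 0 * Dgen (2 * k + 1) 1) ^ (2 * k + 1) = Dz (2 * k + 1) := by
    rw [Dz_odd]
    nth_rewrite 2 [DDelta_eq]
    rw [DDelta_eq', mul_assoc, ← mul_assoc (Dgen _ 0), ← pow_succ', ← pow_add]
    congr 1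
    ring
  rw [rot, pow_right_comm, h]

theorem closure_rot_DDelta : Subgroup.closure {rot k, DDelta (2 * k + 1)} = ⊤ := by
  rw [eq_top_iff, ← closure_Dgen, Subgroup.closure_le]
  have hr : rot k ∈ Subgroup.closure {rot k, DDelta (2 * k + 1)} :=
    Subgroup.subset_closure (by simp)
  have hd : DDelta (2 * k + 1) ∈ Subgroup.closure {rot k, DDelta (2 * k + 1)} :=
    Subgroup.subset_closure (by simp)
  have ht : Dgen (2 * k + 1) 1 ∈ Subgroup.closure {rot k, DDelta (2 * k + 1)} := by
    rw [Dgen_one_eq]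
    exact mul_mem hd (inv_mem hr)
  rintro _ (rfl | rfl)
  · rw [eq_mul_inv_of_mul_eq (Dgen_zero_mul_DDelta (k := k))]
    exact mul_mem (mul_mem hd ht) (inv_mem hd)
  · exact ht

end Odd

end DihedralArtin

/-- The products of elements `y * x ^ i` with `0 < i < m`. -/
inductive IsSyllableProd {G : Type*} [Group G] (x y : G) (m : ℕ) : G → Prop
  | one : IsSyllableProd x y m 1
  | mul {i : ℕ} {w : G} (hi : 0 < i) (him : i < m) (hw : IsSyllableProd x y m w) :
      IsSyllableProd x y m (y * x ^ i * w)

/-- The elements `z ^ j * x ^ i * w * (y * x⁻¹) ^ n` with `i < m` and `w` a product of elements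
`y * x ^ l` with `0 < l < m`. -/
def HasNormalForm {G : Type*} [Group G] (x y z : G) (m : ℕ) (g : G) : Prop :=
  ∃ (j n : ℤ) (i : ℕ) (w : G), i < m ∧ IsSyllableProd x y m w ∧
    g = z ^ j * (x ^ i * w * (y * x⁻¹) ^ n)

namespace HasNormalForm

variable {G : Type*} [Group G] {x y z : G} {m k : ℕ}

theorem central_mul {g : G} (hg : HasNormalForm x y z m g) (j : ℤ) :
    HasNormalForm x y z m (z ^ j * g) := by
  obtain ⟨j', n, i, w, hi, hw, rfl⟩ := hg
  exact ⟨j + j', n, i, w, hi, hw, by rw [zpow_add]; simp only [mul_assoc]⟩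

theorem rot_mul (hz : ∀ g, Commute z g) (hx : x ^ m = z ^ k) {g : G}
    (hg : HasNormalForm x y z m g) : HasNormalForm x y z m (x * g) := by
  obtain ⟨j, n, i, w, hi, hw, rfl⟩ := hg
  rw [((hz x).zpow_left j).symm.left_comm]
  apply central_mul
  rcases (Nat.succ_le_of_lt hi).lt_or_eq with h | h
  · exact ⟨0, n, i + 1, w, h, hw, by simp [pow_succ', mul_assoc]⟩
  · refine ⟨k, n, 0, w, by omega, hw, ?_⟩
    rw [← mul_assoc, ← mul_assoc, ← pow_succ', ← Nat.succ_eq_add_one, h, hx, zpow_natCast]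
    simp [mul_assoc]

theorem involution_mul (hm : 1 < m) (hz : ∀ g, Commute z g) (hx : x ^ m = z ^ k)
    (hy : y * y = z) {g : G} (hg : HasNormalForm x y z m g) :
    HasNormalForm x y z m (y * g) := by
  obtain ⟨j, n, i, w, hi, hw, rfl⟩ := hg
  rw [((hz y).zpow_left j).symm.left_comm]
  apply central_mul
  rcases Nat.eq_zero_or_pos i with rfl | hi0
  · cases hw with
    | one =>
      refine ⟨1 - k, n - 1, m - 1, 1, by omega, .one, ?_⟩
      have hx' : x ^ (m - 1) = z ^ k * x⁻¹ := by
        rw [← hx, eq_mul_inv_iff_mul_eq, ← pow_succ, Nat.sub_add_cancel hm.le]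
      have : (y * x⁻¹) ^ n = (y * x⁻¹) * (y * x⁻¹) ^ (n - 1) := by
        rw [← zpow_one_add]; congr 1; ring
      rw [this, hx', zpow_sub z, zpow_one, zpow_natCast]
      simp only [mul_assoc, inv_mul_cancel_left, pow_zero, one_mul]
      rw [← hy, mul_assoc]
    | @mul l v hl hlm hv =>
      refine ⟨1, n, l, v, hlm, hv, ?_⟩
      rw [← hy]
      group
  · exact ⟨0, n, 0, y * x ^ i * w, by omega, .mul hi0 hi hw, by simp [mul_assoc]⟩

theorem of_closure (hm : 1 < m) (hz : ∀ g, Commute z g) (hx : x ^ m = z ^ k)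
    (hy : y * y = z) {g : G} (hg : g ∈ Subgroup.closure {x, y}) : HasNormalForm x y z m g := by
  have hpow (n : ℕ) {v : G} (hv : HasNormalForm x y z m v) : HasNormalForm x y z m (x ^ n * v) := by
    induction n with
    | zero => simpa
    | succ n ih => rw [pow_succ', mul_assoc]; exact ih.rot_mul hz hx
  induction hg using Subgroup.closure_induction_left with
  | one => exact ⟨0, 0, 0, 1, by omega, .one, by simp⟩
  | mul_left a ha v _ hv =>
    rcases ha with rfl | rfl
    · exact hv.rot_mul hz hx
    · exact hv.involution_mul hm hz hx hy
  | inv_mul_cancel a ha v _ hv =>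
    rcases ha with rfl | rfl
    · have : a⁻¹ = z ^ (-k : ℤ) * a ^ (m - 1) := by
        rw [zpow_neg, zpow_natCast, ← hx, eq_inv_mul_iff_mul_eq, mul_inv_eq_iff_eq_mul, ← pow_succ,
          Nat.sub_add_cancel hm.le]
      rw [this, mul_assoc]
      exact (hpow _ hv).central_mul _
    · have : a⁻¹ = z ^ (-1 : ℤ) * a := by
        rw [← hy]; group
      rw [this, mul_assoc]
      exact (hv.involution_mul hm hz hx hy).central_mul _

end HasNormalForm

namespace HeckeMatrix

open Matrix Real

/-- The matrix of order two modulo its centre in the Hecke group. -/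
def involution : GL (Fin 2) ℝ :=
  ⟨!![0, -1; 1, 0], !![0, 1; -1, 0], by simp [one_fin_two], by simp [one_fin_two]⟩

/-- The elliptic generator with trace `2 cos θ` of the Hecke group. -/
noncomputable def elliptic (θ : ℝ) : GL (Fin 2) ℝ :=
  ⟨!![2 * cos θ, -1; 1, 0], !![0, 1; -1, 2 * cos θ], by simp [one_fin_two], by simp [one_fin_two]⟩

theorem involution_mul_self : involution * involution = -1 := by
  ext i j
  fin_cases i <;> fin_cases j <;> simp [involution]

theorem parabolic_pow (θ : ℝ) (n : ℕ) :
    ((involution * (elliptic θ)⁻¹) ^ n).val = !![1, -(n * (2 * cos θ)); 0, 1] := by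
  induction n with
  | zero => simp [one_fin_two]
  | succ n ih =>
    rw [pow_succ, Units.val_mul, ih, Units.val_mul]
    simp [involution, elliptic]
    ring

theorem elliptic_pow {θ : ℝ} (hθ : sin θ ≠ 0) (n : ℕ) :
    (elliptic θ ^ n).val =
      !![sin ((n + 1) * θ) / sin θ, -(sin (n * θ) / sin θ);
        sin (n * θ) / sin θ, -(sin ((n - 1) * θ) / sin θ)] := by
  have key (r : ℝ) : sin ((r + 1) * θ) = 2 * cos θ * sin (r * θ) - sin ((r - 1) * θ) := by
    rw [add_mul, sub_mul, one_mul, sin_add, sin_sub]; ring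
  induction n with
  | zero => simp [one_fin_two, hθ]
  | succ n ih =>
    rw [pow_succ', Units.val_mul, ih]
    have h := key (n + 1)
    have h' := key n
    simp only [elliptic, Nat.cast_succ, add_sub_cancel_right] at h ⊢
    rw [h]
    simp
    refine ⟨by ring, ?_⟩
    rw [h']; ring

theorem elliptic_pow_eq_neg_one {m : ℕ} (hm : 2 ≤ m) : elliptic (π / m) ^ m = -1 := by
  have hm0 : (m : ℝ) ≠ 0 := by positivity
  have hs : sin (π / m) ≠ 0 :=
    (sin_pos_of_pos_of_lt_pi (by positivity) (div_lt_self pi_pos (by exact_mod_cast hm))).ne'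
  apply Units.ext
  rw [elliptic_pow hs, add_mul, sub_mul, mul_div_cancel₀ _ hm0, one_mul, sin_add, sin_sub]
  simp [hs, one_fin_two]

theorem sin_ratio_pos {m i : ℕ} (hi : 0 < i) (him : i < m) : 0 < sin (i * (π / m)) / sin (π / m) := by
  have hm : (0 : ℝ) < m := by exact_mod_cast hi.trans him
  have aux {j : ℕ} (hj : 0 < j) (hjm : j < m) : 0 < sin (j * (π / m)) := by
    have hj' : (0 : ℝ) < j := by exact_mod_cast hj
    have hjm' : (j : ℝ) < m := by exact_mod_cast hjm
    apply sin_pos_of_pos_of_lt_pi (by positivity)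
    rw [mul_div_assoc', div_lt_iff₀ hm, mul_comm]
    gcongr
  have h1 := aux one_pos (by omega)
  rw [Nat.cast_one, one_mul] at h1
  exact div_pos (aux hi him) h1


theorem sign_mul_entry {e : GL (Fin 2) ℝ} (he : e = 1 ∨ e = -1) :
    ∃ σ : ℝ, σ * σ = 1 ∧ ∀ (A : GL (Fin 2) ℝ) (i j : Fin 2), (e * A).val i j = σ * A.val i j := by
  rcases he with rfl | rfl
  · exact ⟨1, by simp⟩
  · exact ⟨-1, by simp⟩

theorem sign_mul {e e' : GL (Fin 2) ℝ} (he : e = 1 ∨ e = -1) (he' : e' = 1 ∨ e' = -1) :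
    e * e' = 1 ∨ e * e' = -1 := by
  rcases he with rfl | rfl <;> rcases he' with rfl | rfl <;> simp

theorem sign_pow {e : GL (Fin 2) ℝ} (he : e = 1 ∨ e = -1) (n : ℕ) : e ^ n = 1 ∨ e ^ n = -1 := by
  rcases he with rfl | rfl
  · simp
  · exact neg_one_pow_eq_or _ n

theorem sign_commute {e : GL (Fin 2) ℝ} (he : e = 1 ∨ e = -1) (A : GL (Fin 2) ℝ) :
    Commute e A := by
  rcases he with rfl | rfl
  · exact Commute.one_left A
  · exact Commute.neg_one_left A

section Stabilizer

variable {G : Type*} [Group G] {x y z : G} {m : ℕ} {f : G →* GL (Fin 2) ℝ} {e : GL (Fin 2) ℝ}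

theorem syllableProd_first_column (he : e = 1 ∨ e = -1) (hx : f x = e * elliptic (π / m))
    (hy : f y = e * involution) {w : G} (hw : IsSyllableProd x y m w) :
    (f w).val 0 0 ≠ 0 ∧ (f w).val 0 0 * (f w).val 1 0 ≤ 0 ∧
      ((f w).val 1 0 = 0 → w ∈ Subgroup.zpowers (y * x ^ (m - 1))) := by
  induction hw with
  | one => simp
  | @mul i w hi him hw ih =>
    obtain ⟨hp, hpq, hq⟩ := ih
    have hs : sin (π / m) ≠ 0 := fun h => by simpa [h] using sin_ratio_pos hi him
    obtain ⟨σ, hσ, hent⟩ := sign_mul_entry (sign_mul he (sign_pow he i))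
    have hf : f (y * x ^ i * w) = e * e ^ i * (involution * (elliptic (π / m) ^ i * f w)) := by
      rw [map_mul, map_mul, map_pow, hx, hy, (sign_commute he _).mul_pow]
      simp only [mul_assoc]
      rw [((sign_commute he involution).pow_left i).symm.left_comm]
    have ha := sin_ratio_pos hi him
    have hb : 0 ≤ sin ((i - 1) * (π / m)) / sin (π / m) := by
      rcases Nat.eq_or_lt_of_le hi with h | h
      · simp [← h]
      · have := sin_ratio_pos (m := m) (i := i - 1) (by omega) (by omega)
        rw [Nat.cast_pred hi] at this
        exact this.le
    have hc : i + 1 = m ∨ 0 < sin ((i + 1) * (π / m)) / sin (π / m) := by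
      refine (Nat.eq_or_lt_of_le him).imp id fun h => ?_
      exact_mod_cast sin_ratio_pos (m := m) (i := i + 1) (by omega) h
    have hc0 : i + 1 = m → sin ((i + 1) * (π / m)) / sin (π / m) = 0 := by
      rintro rfl
      rw [Nat.cast_succ, mul_div_cancel₀ _ (by positivity)]
      simp
    have hp' : (f (y * x ^ i * w)).val 0 0 = σ * -(sin (i * (π / m)) / sin (π / m) * (f w).val 0 0
        - sin ((i - 1) * (π / m)) / sin (π / m) * (f w).val 1 0) := by
      rw [hf, hent, Units.val_mul, Units.val_mul, elliptic_pow hs]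
      congr 1
      simp [involution, Matrix.vecMul_eq_sum, Fin.sum_univ_two]
      ring
    have hq' : (f (y * x ^ i * w)).val 1 0 = σ * (sin ((i + 1) * (π / m)) / sin (π / m) *
        (f w).val 0 0 - sin (i * (π / m)) / sin (π / m) * (f w).val 1 0) := by
      rw [hf, hent, Units.val_mul, Units.val_mul, elliptic_pow hs]
      congr 1
      simp [involution, Matrix.vecMul_eq_sum, Fin.sum_univ_two]
      ring
    rw [hp', hq']
    generalize sin (i * (π / m)) / sin (π / m) = a at *
    generalize sin ((i - 1) * (π / m)) / sin (π / m) = b at *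
    generalize sin ((i + 1) * (π / m)) / sin (π / m) = c at *
    generalize (f w).val 0 0 = p at *
    generalize (f w).val 1 0 = q at *
    have hc' : 0 ≤ c := hc.elim (fun h => (hc0 h).ge) le_of_lt
    have hσ0 : σ ≠ 0 := by rintro rfl; simp at hσ
    have hpp : 0 < p * p := mul_self_pos.mpr hp
    have h1 : b * (p * q) ≤ 0 := mul_nonpos_of_nonneg_of_nonpos hb hpq
    have h2 : 0 < a * (p * p) := mul_pos ha hpp
    refine ⟨mul_ne_zero hσ0 fun h => ?_, ?_, fun h => ?_⟩
    · have : a * (p * p) - b * (p * q) = 0 := by linear_combination -p * h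
      linarith
    · have h3 : 0 ≤ a * c * (p * p) := by positivity
      have h4 : (a * a + b * c) * (p * q) ≤ 0 :=
        mul_nonpos_of_nonneg_of_nonpos (by positivity) hpq
      have h5 : 0 ≤ a * b * (q * q) := mul_nonneg (by positivity) (mul_self_nonneg q)
      have h6 : σ * -(a * p - b * q) * (σ * (c * p - a * q)) =
          -(a * c * (p * p)) + (a * a + b * c) * (p * q) - a * b * (q * q) := by
        linear_combination (-(a * p - b * q) * (c * p - a * q)) * hσ
      linarith
    · have h3 : c * p - a * q = 0 := (mul_eq_zero.mp h).resolve_left hσ0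
      have h4 : a * (p * q) ≤ 0 := mul_nonpos_of_nonneg_of_nonpos ha.le hpq
      have h5 : c * (p * p) = a * (p * q) := by linear_combination p * h3
      rcases hc with hc | hc
      · have hq0 : q = 0 := by
          rw [hc0 hc, zero_mul, zero_sub, neg_eq_zero] at h3
          exact (mul_eq_zero.mp h3).resolve_left ha.ne'
        rw [show i = m - 1 by omega]
        exact mul_mem (Subgroup.mem_zpowers _) (hq hq0)
      · have := mul_pos hc hpp
        linarith

theorem map_parabolic (he : e = 1 ∨ e = -1) {θ : ℝ} (hx : f x = e * elliptic θ)
    (hy : f y = e * involution) : f (y * x⁻¹) = involution * (elliptic θ)⁻¹ := by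
  rw [map_mul, map_inv, hx, hy, (sign_commute he (elliptic θ)).eq, (sign_commute he involution).eq]
  group

theorem entry_eq_zero_of_commute (hm : 3 ≤ m) (he : e = 1 ∨ e = -1)
    (hx : f x = e * elliptic (π / m)) (hy : f y = e * involution) {g : G} {n : ℤ} (hn : n ≠ 0)
    (hg : Commute g ((y * x⁻¹) ^ n)) : (f g).val 1 0 = 0 := by
  have hm' : (3 : ℝ) ≤ m := by exact_mod_cast hm
  have hcos : 0 < cos (π / m) := by
    refine cos_pos_of_mem_Ioo ⟨by linarith [pi_pos, show 0 < π / m by positivity], ?_⟩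
    exact div_lt_div_of_pos_left pi_pos two_pos (by linarith)
  have hg' : Commute g ((y * x⁻¹) ^ n.natAbs) := by
    rcases n.natAbs_eq with h | h <;> rw [h] at hg
    · rwa [zpow_natCast] at hg
    · rwa [_root_.zpow_neg, zpow_natCast, Commute.inv_right_iff] at hg
  have hN : (n.natAbs : ℝ) ≠ 0 := by simpa using hn
  have h := congrArg Units.val (hg'.map f).eq
  rw [map_pow, map_parabolic he hx hy, Units.val_mul, Units.val_mul, parabolic_pow] at h
  have h00 := congrFun (congrFun h 0) 0
  simp only [Matrix.mul_apply, Fin.sum_univ_two] at h00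
  simp only [of_apply, cons_val', cons_val_zero, cons_val_one, cons_val_fin_one, mul_one, mul_zero,
    add_zero, one_mul, left_eq_add, neg_mul, neg_eq_zero, mul_eq_zero] at h00
  rcases h00 with (h | h | h) | h
  · exact absurd h hN
  · norm_num at h
  · exact absurd h hcos.ne'
  · exact h

theorem exists_eq_zpow_mul_zpow_of_commute {k : ℕ} (hm : 3 ≤ m) (he : e = 1 ∨ e = -1)
    (hx : f x = e * elliptic (π / m)) (hy : f y = e * involution)
    (hz : ∀ g, Commute z g) (hxz : x ^ m = z ^ k) (hyz : y * y = z)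
    (hgen : Subgroup.closure {x, y} = ⊤) {g : G} {n : ℤ} (hn : n ≠ 0)
    (hg : Commute g ((y * x⁻¹) ^ n)) : ∃ i j : ℤ, g = z ^ i * (y * x⁻¹) ^ j := by
  obtain ⟨j, l, i, w, hi, hw, rfl⟩ :=
    HasNormalForm.of_closure (by omega) hz hxz hyz (g := g) (by rw [hgen]; trivial)
  have hcomm : Commute (x ^ i * w) ((y * x⁻¹) ^ n) := by
    have := (((hz ((y * x⁻¹) ^ n)).zpow_left (-j)).mul_left hg).mul_left
      (((Commute.refl (y * x⁻¹)).zpow_left (-l)).zpow_right n)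
    simpa [mul_assoc] using this
  have h10 := entry_eq_zero_of_commute hm he hx hy hn hcomm
  rcases Nat.eq_zero_or_pos i with rfl | hi0
  · rw [pow_zero, one_mul] at h10 ⊢
    obtain ⟨r, rfl⟩ := Subgroup.mem_zpowers_iff.mp ((syllableProd_first_column he hx hy hw).2.2 h10)
    have hu : y * x ^ (m - 1) = z ^ k * (y * x⁻¹) := by
      rw [((hz y).pow_left k).left_comm, ← hxz, ← pow_sub_one_mul (by omega : m ≠ 0) x,
        mul_inv_cancel_right]
    refine ⟨j + k * r, r + l, ?_⟩
    rw [hu, ((hz _).pow_left k).mul_zpow, _root_.zpow_add, _root_.zpow_add, _root_.zpow_mul,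
      zpow_natCast]
    simp only [mul_assoc]
  · obtain ⟨σ, -, hent⟩ := sign_mul_entry he
    refine absurd ?_ (syllableProd_first_column he hx hy (.mul hi0 hi hw)).1
    rw [mul_assoc, map_mul, hy, mul_assoc, hent, Units.val_mul, Matrix.mul_apply, Fin.sum_univ_two,
      h10]
    simp [involution]

end Stabilizer

end HeckeMatrix

namespace DihedralArtin

open Real HeckeMatrix

variable {k : ℕ}

theorem braid_relation_of_central {G : Type*} [Group G] {x y c d : G} (hc : ∀ g, Commute c g)
    (hd : ∀ g, Commute d g) (hy : y * y = c) (hx : x ^ (2 * k + 1) = d) :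
    altProd (x⁻¹ * y) (y * x⁻¹) (2 * k + 1) = c ^ k * d⁻¹ * y ∧
    altProd (y * x⁻¹) (x⁻¹ * y) (2 * k + 1) = c ^ k * d⁻¹ * y := by
  have hst : x⁻¹ * y * (y * x⁻¹) = c * (x ^ 2)⁻¹ := by
    rw [mul_assoc, ← mul_assoc y, hy, ← (hc x⁻¹).left_comm]
    group
  have hpow : (x⁻¹ * y * (y * x⁻¹)) ^ k = c ^ k * (x * d⁻¹) := by
    rw [hst, (hc _).mul_pow, inv_pow, ← pow_mul, ← hx, pow_succ, mul_inv_rev, mul_inv_cancel_left]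
  constructor
  · rw [altProd_two_mul_add_one, mul_mul_pow_comm, hpow, mul_assoc, mul_assoc, mul_assoc,
      (hd x⁻¹).inv_left.left_comm, mul_inv_cancel_left]
  · rw [altProd_two_mul_add_one, hpow, ((hc _).pow_left k).symm.left_comm, mul_assoc, mul_assoc,
      inv_mul_cancel_left, ((hd y).inv_left).eq]

theorem exists_heckeRepresentation (k : ℕ) (hk : 0 < k) :
    ∃ (f : DihedralArtin (2 * k + 1) →* Matrix.GeneralLinearGroup (Fin 2) ℝ)
      (e : Matrix.GeneralLinearGroup (Fin 2) ℝ), (e = 1 ∨ e = -1) ∧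
      f (rot k) = e * elliptic (π / (2 * k + 1 : ℕ)) ∧
      f (DDelta (2 * k + 1)) = e * involution := by
  obtain ⟨h1, h2⟩ := braid_relation_of_central (k := k) (fun g => sign_commute (.inr rfl) g)
    (fun g => sign_commute (.inr rfl) g) involution_mul_self
    (elliptic_pow_eq_neg_one (m := 2 * k + 1) (by omega))
  have he := sign_mul (sign_pow (.inr rfl) k) (e' := (-1)⁻¹) (.inr (by simp))
  have hD : lift _ _ (h1.trans h2.symm) (DDelta (2 * k + 1)) = (-1) ^ k * (-1)⁻¹ * involution := by
    rw [DDelta, map_altProd, lift_Dgen_zero, lift_Dgen_one, h1]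
  refine ⟨lift _ _ (h1.trans h2.symm), _, he, ?_, hD⟩
  rw [rot_eq, map_mul, map_inv, hD, lift_Dgen_one, mul_inv_rev, inv_inv,
    ((sign_commute he _).symm).left_comm, inv_mul_cancel_right]

theorem exists_eq_of_commute_Dgen_one_zpow (hk : 0 < k) {g : DihedralArtin (2 * k + 1)} {n : ℤ}
    (hn : n ≠ 0) (hg : Commute g (Dgen (2 * k + 1) 1 ^ n)) :
    ∃ i j : ℤ, g = Dz (2 * k + 1) ^ i * Dgen (2 * k + 1) 1 ^ j := by
  obtain ⟨f, e, he, hx, hy⟩ := exists_heckeRepresentation k hk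
  rw [Dgen_one_eq] at hg ⊢
  exact exists_eq_zpow_mul_zpow_of_commute (by omega) he hx hy Dz_commute rot_pow Dz_odd.symm
    closure_rot_DDelta hn hg

end DihedralArtin

/-- In the dihedral Artin group `A_m` with `m ≥ 2`: if `⟨s⟩ ∩ h⟨t⟩h⁻¹`
is non-trivial, then `m` is odd and there is `w ∈ ⟨z⟩` with `h⟨t⟩ = Δw⟨t⟩`; in particular
`h⟨t⟩h⁻¹ = ⟨s⟩`. -/
theorem dihedralArtin_different_type_edges (m : ℕ) (hm : 2 ≤ m) (h : DihedralArtin m)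
    (hne : Subgroup.zpowers (Dgen m 0) ⊓ conjSub h (Subgroup.zpowers (Dgen m 1)) ≠ ⊥) :
    Odd m ∧
    (∃ w ∈ Subgroup.zpowers (Dz m), (DDelta m * w)⁻¹ * h ∈ Subgroup.zpowers (Dgen m 1)) ∧
    conjSub h (Subgroup.zpowers (Dgen m 1)) = Subgroup.zpowers (Dgen m 0) := by
  obtain ⟨⟨g, ⟨a, ha⟩, ⟨_, ⟨b, rfl⟩, hb⟩⟩, hg⟩ := Subgroup.ne_bot_iff_exists_ne_one.mp hne
  have hab : Dgen m 0 ^ a = h * Dgen m 1 ^ b * h⁻¹ := ha.trans hb.symm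
  have ha0 : a ≠ 0 := by
    rintro rfl
    exact hg (Subtype.ext (by simpa using ha.symm))
  obtain ⟨k, rfl⟩ : Odd m :=
    Nat.not_even_iff_odd.mp fun he => ha0 (DihedralArtin.exponent_eq_zero_of_even he hab)
  obtain rfl := DihedralArtin.exponents_eq hab
  have hs := eq_mul_inv_of_mul_eq (DihedralArtin.Dgen_zero_mul_DDelta (k := k))
  have hcomm : Commute ((DDelta (2 * k + 1))⁻¹ * h) (Dgen (2 * k + 1) 1 ^ a) := by
    rw [hs, conj_zpow] at hab
    generalize Dgen (2 * k + 1) 1 ^ a = u at hab ⊢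
    rw [commute_iff_eq, mul_assoc, mul_inv_eq_iff_eq_mul.mp hab.symm]
    group
  obtain ⟨i, j, hij⟩ := DihedralArtin.exists_eq_of_commute_Dgen_one_zpow (by omega) ha0 hcomm
  obtain rfl := eq_mul_of_inv_mul_eq hij
  refine ⟨⟨k, rfl⟩, ⟨_, ⟨i, rfl⟩, ⟨j, by group⟩⟩, ?_⟩
  rw [conjSub, MonoidHom.map_zpowers, hs]
  congr 1
  have hz := ((DihedralArtin.Dz_commute (Dgen (2 * k + 1) 1)).zpow_left i).mul_left
    ((Commute.refl (Dgen (2 * k + 1) 1)).zpow_left j)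
  change _ * _ * Dgen (2 * k + 1) 1 * (_ * _)⁻¹ = _
  rw [mul_assoc (DDelta _), hz.eq, mul_inv_rev]
  group
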